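/- arXiv:0811.4346 — 2 statements merged into one kernel-verified Lean document; each statement's English description precedes it below -/
import Mathlib

section
/- For every integer m ≥ 2 and every integer t ≥ 1: any algorithm for the ball-shuffling problem using t bins whose total cost on n balls is at most (m/2)·n must satisfy n < (2t)^m. Equivalently, an algorithm with average cost u per ball (u a half-integer, u ≥ 1) using t bins cannot accommodate (2t)^{2u} balls or more. -/
/-- One shuffle step in the ball-shuffling problem with `t` bins:
a set `I` of bins is emptied, the new ball is added to the collected balls,
and the collected balls are redistributed among bins that are empty after the
collection (bins not in `I` that are nonempty keep their contents).
The cost is `(∑ i ∈ I, b i) + 1`. -/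
def ShuffleStep (t : ℕ) (b b' : Fin t → ℕ) (c : ℕ) : Prop :=
  ∃ I : Finset (Fin t),
    c = (∑ i ∈ I, b i) + 1 ∧
    (∀ i, i ∉ I → b i ≠ 0 → b' i = b i) ∧
    (∑ i, b' i) = (∑ i, b i) + 1

/-- An algorithm (run) for the ball-shuffling problem with `t` bins and `n` balls:
a sequence of configurations starting from all-empty bins, where the `k`-th step
is a valid shuffle of cost `c k`. -/
def IsRun (t n : ℕ) (b : ℕ → Fin t → ℕ) (c : ℕ → ℕ) : Prop :=
  (∀ i, b 0 i = 0) ∧ ∀ k, k < n → ShuffleStep t (b k) (b (k + 1)) (c k)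

/-- `shuffleCost t n` is the minimum total cost of any algorithm for the
ball-shuffling problem with `n` balls and `t` bins. -/
noncomputable def shuffleCost (t n : ℕ) : ℕ :=
  sInf { s | ∃ b c, IsRun t n b c ∧ s = ∑ k ∈ Finset.range n, c k }

/-- A labelling of a run of `n` balls: `pos k j` is the bin of ball `j` before step `k`, and `I k` is
the set of bins emptied at step `k`. Balls outside `I k` stay in place, and a nonempty bin outside
`I k` receives no ball. -/
structure IsLabelling (t n : ℕ) (pos : ℕ → ℕ → Fin t) (I : ℕ → Finset (Fin t)) : Prop where
  stay : ∀ k < n, ∀ j < k, pos k j ∉ I k → pos (k + 1) j = pos k j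
  closed : ∀ k < n, ∀ j < k, pos k j ∉ I k → ∀ j' ≤ k, pos (k + 1) j' = pos k j →
    j' < k ∧ pos k j' = pos k j

/-- The cost incurred by the balls arriving in the window `[a, e)` before time `e`. -/
def windowCost {t : ℕ} (pos : ℕ → ℕ → Fin t) (I : ℕ → Finset (Fin t)) (a e : ℕ) : ℕ :=
  ∑ j ∈ Finset.Ico a e, (1 + ((Finset.Ioo j e).filter fun k => pos k j ∈ I k).card)

/-- A function on a finset with prescribed fiber sizes. -/
theorem exists_fiber_card_eq {ι : Type*} [Fintype ι] [DecidableEq ι] (S : Finset ℕ) (d : ι → ℕ)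
    (i₀ : ι) (h : ∑ i, d i = S.card) :
    ∃ g : ℕ → ι, ∀ i, (S.filter fun j => g j = i).card = d i := by
  have hc : Fintype.card S = Fintype.card (Σ i, Fin (d i)) := by simp [h]
  let φ := Fintype.equivOfCardEq hc
  refine ⟨fun j => if hj : j ∈ S then (φ ⟨j, hj⟩).1 else i₀, fun i => ?_⟩
  rw [← Fintype.card_fin (d i), ← Finset.card_univ]
  symm
  refine Finset.card_bij (fun x _ => (φ.symm ⟨i, x⟩ : ℕ)) ?_ ?_ ?_
  · intro x _
    simp
  · intro x _ y _ hxy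
    simpa using φ.symm.injective (Subtype.ext hxy)
  · intro j hj
    obtain ⟨hjS, hji⟩ := Finset.mem_filter.1 hj
    simp only [dif_pos hjS] at hji
    subst hji
    exact ⟨(φ ⟨j, hjS⟩).2, Finset.mem_univ _, by simp⟩

/-- A shuffle step can be realised on labelled balls. -/
theorem exists_pos_succ {t k : ℕ} {b b' : Fin t → ℕ} {I : Finset (Fin t)}
    (hkeep : ∀ i, i ∉ I → b i ≠ 0 → b' i = b i) (hsum : ∑ i, b' i = ∑ i, b i + 1)
    (p : ℕ → Fin t) (hp : ∀ i, ((Finset.range k).filter fun j => p j = i).card = b i) :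
    ∃ p' : ℕ → Fin t, (∀ i, ((Finset.range (k + 1)).filter fun j => p' j = i).card = b' i) ∧
      ∀ j < k, p j ∉ I → p' j = p j := by
  set U := (Finset.range k).filter fun j => p j ∉ I with hU
  set S := Finset.range (k + 1) \ U with hS
  have hUsub : U ⊆ Finset.range (k + 1) := fun j hj => by
    simp only [hU, Finset.mem_filter, Finset.mem_range] at hj ⊢
    omega
  have hUfib : ∀ i, (U.filter fun j => p j = i).card = if i ∈ I then 0 else b i := by
    intro i
    split_ifs with hi
    · rw [Finset.card_eq_zero, Finset.filter_eq_empty_iff]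
      rintro j hj rfl
      exact (Finset.mem_filter.1 hj).2 hi
    · rw [← hp i, hU, Finset.filter_filter]
      congr 1
      ext j
      simp only [Finset.mem_filter, Finset.mem_range]
      grind
  have hle : ∀ i, (if i ∈ I then 0 else b i) ≤ b' i := by
    intro i
    split_ifs with hi
    · exact Nat.zero_le _
    · by_cases h0 : b i = 0
      · omega
      · exact (hkeep i hi h0).ge
  have hk : ∑ i, b i = k := by
    simp_rw [← hp]
    rw [← Finset.card_eq_sum_card_fiberwise (fun _ _ => Finset.mem_coe.2 (Finset.mem_univ _)),
      Finset.card_range]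
  have hUcard : ∑ i, (if i ∈ I then 0 else b i) = U.card := by
    simp_rw [← hUfib]
    rw [← Finset.card_eq_sum_card_fiberwise (fun _ _ => Finset.mem_coe.2 (Finset.mem_univ _))]
  have hScard : ∑ i, (b' i - if i ∈ I then 0 else b i) = S.card := by
    rw [hS, Finset.card_sdiff_of_subset hUsub, Finset.card_range, ← hUcard,
      Finset.sum_tsub_distrib _ fun i _ => hle i]
    omega
  obtain ⟨g, hg⟩ := exists_fiber_card_eq S _ (p 0) hScard
  refine ⟨fun j => if j ∈ U then p j else g j, fun i => ?_, fun j hj hjI => ?_⟩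
  · have hsplit : ((Finset.range (k + 1)).filter fun j => (if j ∈ U then p j else g j) = i) =
        (U.filter fun j => p j = i) ∪ (S.filter fun j => g j = i) := by
      ext j
      have := @hUsub j
      simp only [hS, Finset.mem_filter, Finset.mem_union, Finset.mem_sdiff]
      grind
    rw [hsplit, Finset.card_union_of_disjoint, hUfib, hg]
    · have := hle i
      omega
    · refine Finset.disjoint_filter_filter ?_
      exact Finset.disjoint_sdiff
  · have : j ∈ U := Finset.mem_filter.2 ⟨Finset.mem_range.2 hj, hjI⟩
    simp [this]

/-- Every run admits a labelling whose total cost is that of the run. -/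
theorem IsRun.exists_isLabelling {t n : ℕ} (ht : 1 ≤ t) {b : ℕ → Fin t → ℕ} {c : ℕ → ℕ}
    (h : IsRun t n b c) :
    ∃ pos I, IsLabelling t n pos I ∧ windowCost pos I 0 n = ∑ k ∈ Finset.range n, c k := by
  obtain ⟨h0, hstep⟩ := h
  choose! I hc hkeep hsum using hstep
  have hnext : ∀ k (p : ℕ → Fin t), ∃ p' : ℕ → Fin t, k < n →
      (∀ i, ((Finset.range k).filter fun j => p j = i).card = b k i) →
      (∀ i, ((Finset.range (k + 1)).filter fun j => p' j = i).card = b (k + 1) i) ∧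
      ∀ j < k, p j ∉ I k → p' j = p j := by
    intro k p
    by_cases hk : k < n ∧ ∀ i, ((Finset.range k).filter fun j => p j = i).card = b k i
    · obtain ⟨p', hp'⟩ := exists_pos_succ (hkeep k hk.1) (hsum k hk.1) p hk.2
      exact ⟨p', fun _ _ => hp'⟩
    · exact ⟨p, fun h1 h2 => absurd ⟨h1, h2⟩ hk⟩
  choose f hf using hnext
  obtain ⟨pos, hpos⟩ : ∃ pos : ℕ → ℕ → Fin t, ∀ k, pos (k + 1) = f k (pos k) :=
    ⟨fun k => Nat.rec (fun _ => ⟨0, ht⟩) f k, fun _ => rfl⟩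
  have hcount : ∀ k ≤ n, ∀ i : Fin t,
      ((Finset.range k).filter fun j => pos k j = i).card = b k i := by
    intro k
    induction k with
    | zero => intro _ i; simp [h0]
    | succ k ih => exact fun hk => hpos k ▸ (hf k (pos k) hk (ih (by omega))).1
  have hstay : ∀ k < n, ∀ j < k, pos k j ∉ I k → pos (k + 1) j = pos k j :=
    fun k hk => hpos k ▸ (hf k (pos k) hk (hcount k hk.le)).2
  refine ⟨pos, I, ⟨hstay, ?_⟩, ?_⟩
  · intro k hk j hj hjI j' hj' heq
    have hsub : ((Finset.range k).filter fun l => pos k l = pos k j) ⊆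
        (Finset.range (k + 1)).filter fun l => pos (k + 1) l = pos k j := by
      intro l hl
      simp only [Finset.mem_filter, Finset.mem_range] at hl ⊢
      refine ⟨by omega, ?_⟩
      rw [hstay k hk l hl.1 (by rwa [hl.2]), hl.2]
    have hne : b k (pos k j) ≠ 0 := by
      rw [← hcount k hk.le]
      exact (Finset.card_pos.2 ⟨j, by simp [hj]⟩).ne'
    have heqs := Finset.eq_of_subset_of_card_le hsub (by
      rw [hcount k hk.le, hcount (k + 1) hk, hkeep k hk _ hjI hne])
    have hmem : j' ∈ (Finset.range k).filter fun l => pos k l = pos k j := by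
      rw [heqs]
      simp only [Finset.mem_filter, Finset.mem_range]
      exact ⟨by omega, heq⟩
    simpa using hmem
  · have hck : ∀ k ∈ Finset.range n,
        c k = 1 + ∑ j ∈ Finset.range k, if pos k j ∈ I k then 1 else 0 := by
      intro k hk
      have hk := Finset.mem_range.1 hk
      rw [hc k hk, add_comm, ← Finset.card_filter,
        Finset.card_eq_sum_card_fiberwise (s := (Finset.range k).filter fun j => pos k j ∈ I k)
          (f := pos k) (t := I k) (fun j hj => (Finset.mem_filter.1 hj).2)]
      congr 1
      refine Finset.sum_congr rfl fun i hi => ?_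
      rw [← hcount k hk.le, Finset.filter_filter]
      congr 1
      ext j
      simp only [Finset.mem_filter]
      grind
    rw [Finset.sum_congr rfl hck, windowCost, Finset.sum_add_distrib, Finset.sum_add_distrib]
    simp_rw [Finset.card_filter]
    congr 1
    · simp
    · refine Finset.sum_comm' fun x y => ?_
      simp only [Finset.mem_Ico, Finset.mem_Ioo, Finset.mem_range]
      omega

/-- A ball not moved after time `f` never shares its bin with a ball arriving after `f`. -/
theorem IsLabelling.pos_ne {t n : ℕ} {pos : ℕ → ℕ → Fin t} {I : ℕ → Finset (Fin t)}
    (h : IsLabelling t n pos I) {f e j j' : ℕ} (he : e ≤ n) (hj : j < f) (hj' : f ≤ j')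
    (hje : j' < e) (hun : ∀ k, f ≤ k → k < e → pos k j ∉ I k) : pos e j' ≠ pos e j := by
  have key : ∀ k, j' + 1 ≤ k → k ≤ e → pos k j' ≠ pos k j := by
    intro k hk
    induction k, hk using Nat.le_induction with
    | base =>
      intro hle heq
      rw [h.stay j' (by omega) j (by omega) (hun j' hj' hje)] at heq
      exact lt_irrefl _ (h.closed j' (by omega) j (by omega) (hun j' hj' hje) j' le_rfl heq).1
    | succ k hk ih =>
      intro hle heq
      have hu := hun k (by omega) (by omega)
      rw [h.stay k (by omega) j (by omega) hu] at heq
      exact ih (by omega) (h.closed k (by omega) j (by omega) hu j' (by omega) heq).2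
  exact key e hje le_rfl

/-- Sums over consecutive intervals add up. -/
theorem sum_Ico_blocks (β : ℕ → ℕ) (hβ : Monotone β) (g : ℕ → ℕ) (N : ℕ) :
    ∑ i ∈ Finset.range N, ∑ j ∈ Finset.Ico (β i) (β (i + 1)), g j =
      ∑ j ∈ Finset.Ico (β 0) (β N), g j := by
  induction N with
  | zero => simp
  | succ N ih =>
    rw [Finset.sum_range_succ, ih,
      Finset.sum_Ico_consecutive _ (hβ (Nat.zero_le _)) (hβ (Nat.le_succ _))]

/-- The cost of a window splits into the costs of its blocks and the cost of moving balls after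
the end of their block. -/
theorem windowCost_eq_sum_blocks {t : ℕ} (pos : ℕ → ℕ → Fin t) (I : ℕ → Finset (Fin t))
    (β : ℕ → ℕ) (hβ : Monotone β) (N : ℕ) :
    windowCost pos I (β 0) (β N) = ∑ i ∈ Finset.range N, (windowCost pos I (β i) (β (i + 1)) +
      ∑ j ∈ Finset.Ico (β i) (β (i + 1)),
        ((Finset.Ico (β (i + 1)) (β N)).filter fun k => pos k j ∈ I k).card) := by
  rw [windowCost, ← sum_Ico_blocks β hβ]
  refine Finset.sum_congr rfl fun i hi => ?_
  have hiN : β (i + 1) ≤ β N := hβ (Finset.mem_range.1 hi)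
  rw [windowCost, ← Finset.sum_add_distrib]
  refine Finset.sum_congr rfl fun j hj => ?_
  have hj := Finset.mem_Ico.1 hj
  rw [add_assoc, ← Finset.card_union_of_disjoint, ← Finset.filter_union]
  · congr 3
    ext k
    simp only [Finset.mem_Ioo, Finset.mem_Ico, Finset.mem_union]
    omega
  · refine Finset.disjoint_filter_filter (Finset.disjoint_left.2 fun k => ?_)
    simp only [Finset.mem_Ioo, Finset.mem_Ico]
    omega

/-- At most `t` blocks contain a ball that is not moved after the end of its block. -/
theorem IsLabelling.card_blocks_unmoved_le {t n : ℕ} {pos : ℕ → ℕ → Fin t}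
    {I : ℕ → Finset (Fin t)} (h : IsLabelling t n pos I) (β : ℕ → ℕ) (hβ : Monotone β) (N : ℕ)
    (hN : β N ≤ n) {B : Finset ℕ} (hBN : ∀ i ∈ B, i < N)
    (hB : ∀ i ∈ B, ∃ j ∈ Finset.Ico (β i) (β (i + 1)),
      ∀ k, β (i + 1) ≤ k → k < β N → pos k j ∉ I k) : B.card ≤ t := by
  choose! J hJ hun using hB
  have hne : ∀ i ∈ B, ∀ i' ∈ B, i < i' → pos (β N) (J i') ≠ pos (β N) (J i) := by
    intro i hi i' hi' hlt
    have h1 := Finset.mem_Ico.1 (hJ i hi)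
    have h2 := Finset.mem_Ico.1 (hJ i' hi')
    have h3 : β (i + 1) ≤ β i' := hβ hlt
    have h4 : β (i' + 1) ≤ β N := hβ (hBN i' hi')
    exact h.pos_ne hN h1.2 (by omega) (by omega) (hun i hi)
  have := Finset.card_le_card_of_injOn (s := B) (t := Finset.univ) (fun i => pos (β N) (J i))
    (fun _ _ => Finset.mem_coe.2 (Finset.mem_univ _)) (by
      intro i hi i' hi' heq
      rcases lt_trichotomy i i' with hlt | hlt | hlt
      · exact absurd heq.symm (hne i hi i' hi' hlt)
      · exact hlt
      · exact absurd heq (hne i' hi' i hi hlt))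
  simpa using this

/-- A window of at least `(2 * t) ^ m` balls has average cost more than `m / 2`. -/
theorem IsLabelling.lt_windowCost {t n : ℕ} (ht : 1 ≤ t) {pos : ℕ → ℕ → Fin t}
    {I : ℕ → Finset (Fin t)} (h : IsLabelling t n pos I) (m : ℕ) :
    ∀ a e, a ≤ e → e ≤ n → (2 * t) ^ m ≤ e - a → m * (e - a) < 2 * windowCost pos I a e := by
  induction m with
  | zero =>
    intro a e _ _ hsize
    have : e - a ≤ windowCost pos I a e := by
      rw [windowCost, Finset.sum_add_distrib]
      simp
    simp at hsize ⊢
    omega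
  | succ m ih =>
    intro a e hae hen hsize
    obtain ⟨q, hq⟩ : ∃ q, q = (e - a) / (2 * t) := ⟨_, rfl⟩
    have hT : 0 < 2 * t := by omega
    have hqm : (2 * t) ^ m ≤ q := by
      rw [hq, Nat.le_div_iff_mul_le hT, ← pow_succ]
      exact hsize
    have hqle : 2 * t * q ≤ e - a := hq ▸ Nat.mul_div_le _ _
    have hqlt : e - a < 2 * t * q + 2 * t := by
      have := Nat.lt_mul_div_succ (e - a) hT
      rw [← hq] at this
      linarith
    obtain ⟨β, hβdef⟩ : ∃ β : ℕ → ℕ, β = fun i => if i < 2 * t then a + i * q else e := ⟨_, rfl⟩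
    have hβstep : ∀ i < 2 * t, β i + q ≤ β (i + 1) := by
      intro i hi
      have : (i + 1) * q ≤ 2 * t * q := Nat.mul_le_mul_right _ hi
      rw [add_mul, one_mul] at this
      simp only [hβdef, hi, if_true]
      split_ifs
      · rw [add_mul]; omega
      · omega
    have hβ : Monotone β := by
      refine monotone_nat_of_le_succ fun i => ?_
      by_cases hi : i < 2 * t
      · have := hβstep i hi
        omega
      · simp [hβdef, hi, show ¬ i + 1 < 2 * t by omega]
    have hβ0 : β 0 = a := by simp [hβdef, hT]
    have hβT : β (2 * t) = e := by simp [hβdef]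
    obtain ⟨extra, hextra⟩ : ∃ extra : ℕ → ℕ, extra = fun i =>
        ∑ j ∈ Finset.Ico (β i) (β (i + 1)),
          ((Finset.Ico (β (i + 1)) (β (2 * t))).filter fun k => pos k j ∈ I k).card := ⟨_, rfl⟩
    have hcost := windowCost_eq_sum_blocks pos I β hβ (2 * t)
    rw [Finset.sum_add_distrib, ← hextra, hβ0, hβT] at hcost
    have hbad : ((Finset.range (2 * t)).filter fun i => ¬ q ≤ extra i).card ≤ t := by
      refine h.card_blocks_unmoved_le β hβ (2 * t) (hβT ▸ hen)
        (fun i hi => Finset.mem_range.1 (Finset.mem_filter.1 hi).1) fun i hi => ?_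
      obtain ⟨hiT, hlt⟩ := Finset.mem_filter.1 hi
      by_contra! hall
      refine hlt ?_
      have hcard : q ≤ ∑ j ∈ Finset.Ico (β i) (β (i + 1)), 1 := by
        have := hβstep i (Finset.mem_range.1 hiT)
        simp
        omega
      refine hcard.trans ?_
      rw [hextra]
      refine Finset.sum_le_sum fun j hj => Finset.card_pos.2 ?_
      obtain ⟨k, hk1, hk2, hk3⟩ := hall j hj
      exact ⟨k, Finset.mem_filter.2 ⟨Finset.mem_Ico.2 ⟨hk1, hk2⟩, hk3⟩⟩
    have hgood : t * q ≤ ∑ i ∈ Finset.range (2 * t), extra i := by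
      have hcard := Finset.card_filter_add_card_filter_not (s := Finset.range (2 * t))
        fun i => q ≤ extra i
      rw [Finset.card_range] at hcard
      calc t * q ≤ ((Finset.range (2 * t)).filter fun i => q ≤ extra i).card * q :=
            Nat.mul_le_mul_right _ (by omega)
        _ ≤ ∑ i ∈ (Finset.range (2 * t)).filter fun i => q ≤ extra i, extra i := by
            rw [← smul_eq_mul]
            exact Finset.card_nsmul_le_sum _ _ _ fun i hi => (Finset.mem_filter.1 hi).2
        _ ≤ _ := Finset.sum_le_sum_of_subset (Finset.filter_subset _ _)
    have hblocks : m * (e - a) + 2 * t ≤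
        2 * ∑ i ∈ Finset.range (2 * t), windowCost pos I (β i) (β (i + 1)) := by
      have hlen := sum_Ico_blocks β hβ (fun _ => m) (2 * t)
      simp only [Finset.sum_const, Nat.card_Ico, smul_eq_mul, hβ0, hβT] at hlen
      rw [mul_comm m, ← hlen, Finset.mul_sum]
      calc _ = ∑ i ∈ Finset.range (2 * t), ((β (i + 1) - β i) * m + 1) := by
            simp [Finset.sum_add_distrib]
        _ ≤ _ := by
          refine Finset.sum_le_sum fun i hi => ?_
          have hi := Finset.mem_range.1 hi
          have hstep := hβstep i hi
          have hend : β (i + 1) ≤ e := hβT ▸ hβ hi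
          have := ih (β i) (β (i + 1)) (hβ (Nat.le_succ i)) (by omega) (by omega)
          rw [mul_comm m] at this
          omega
    rw [hcost, add_mul, one_mul]
    linarith

/-- For every integer m ≥ 2 and every integer t ≥ 1: any algorithm for the
ball-shuffling problem using t bins whose total cost on n balls is at most
(m/2)·n must satisfy n < (2t)^m. -/
theorem ball_shuffling_cheap_algorithm_few_balls (m t : ℕ) (hm : 2 ≤ m) (ht : 1 ≤ t)
    (n : ℕ) (b : ℕ → Fin t → ℕ) (c : ℕ → ℕ) (hrun : IsRun t n b c)
    (hcost : ((∑ k ∈ Finset.range n, c k : ℕ) : ℝ) ≤ (m : ℝ) / 2 * (n : ℝ)) :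
    n < (2 * t) ^ m := by
  obtain ⟨pos, I, hL, hC⟩ := hrun.exists_isLabelling ht
  by_contra! hlt
  have := hL.lt_windowCost ht m 0 n (Nat.zero_le n) le_rfl hlt
  rw [hC, Nat.sub_zero] at this
  have hreal : ((m * n : ℕ) : ℝ) < ((2 * ∑ k ∈ Finset.range n, c k : ℕ) : ℝ) := by
    exact_mod_cast this
  rw [Nat.cast_mul, Nat.cast_mul, Nat.cast_ofNat] at hreal
  linarith
end

section
/- For all integers n ≥ 1 and t ≥ 1, the optimal ball-shuffling cost satisfies f_t(n) ≤ f_t(n−1) + 1 + ⌊(n−1)/t⌋: one can run the optimal algorithm for n−1 balls with t bins and then put the last ball into the smallest bin, which costs at most 1 + ⌊(n−1)/t⌋. -/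
theorem IsRun.sum_eq {t n : ℕ} {b : ℕ → Fin t → ℕ} {c : ℕ → ℕ} (h : IsRun t n b c) :
    ∀ k ≤ n, ∑ i, b k i = k := by
  intro k
  induction k with
  | zero => simp [h.1]
  | succ k ih =>
    intro hk
    obtain ⟨_, _, _, hsum⟩ := h.2 k hk
    rw [hsum, ih (by omega)]

/-- Some bin holds at most the average number of balls. -/
theorem exists_bin_le_div {t : ℕ} (ht : 1 ≤ t) (b : Fin t → ℕ) :
    ∃ i, b i ≤ (∑ j, b j) / t := by
  have : Nonempty (Fin t) := ⟨⟨0, ht⟩⟩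
  obtain ⟨i, hi⟩ := Finite.exists_min b
  refine ⟨i, (Nat.le_div_iff_mul_le ht).2 ?_⟩
  simpa [mul_comm] using Finset.card_nsmul_le_sum Finset.univ b (b i) fun j _ => hi j

theorem shuffleStep_update (t : ℕ) (b : Fin t → ℕ) (i : Fin t) :
    ShuffleStep t b (Function.update b i (b i + 1)) (b i + 1) := by
  refine ⟨{i}, by simp, fun j hj _ => ?_, ?_⟩
  · exact Function.update_of_ne (by simpa using hj) _ _
  · rw [Finset.sum_update_of_mem (Finset.mem_univ i),
      ← Finset.add_sum_erase _ b (Finset.mem_univ i), Finset.sdiff_singleton_eq_erase]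
    ring

/-- A run can be extended by one shuffle which puts the new ball into a smallest bin. -/
theorem IsRun.exists_extend {t m : ℕ} (ht : 1 ≤ t) {b : ℕ → Fin t → ℕ} {c : ℕ → ℕ}
    (h : IsRun t m b c) :
    ∃ b' c', IsRun t (m + 1) b' c' ∧
      ∑ k ∈ Finset.range (m + 1), c' k ≤ (∑ k ∈ Finset.range m, c k) + 1 + m / t := by
  obtain ⟨i, hi⟩ := exists_bin_le_div ht (b m)
  rw [h.sum_eq m le_rfl] at hi
  refine ⟨Function.update b (m + 1) (Function.update (b m) i (b m i + 1)),
    Function.update c m (b m i + 1), ⟨?_, fun k hk => ?_⟩, ?_⟩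
  · simpa [Function.update_of_ne] using h.1
  · rw [Function.update_of_ne (by omega : k ≠ m + 1)]
    rcases Nat.lt_succ_iff_lt_or_eq.1 hk with hlt | rfl
    · rw [Function.update_of_ne (by omega : k + 1 ≠ m + 1),
        Function.update_of_ne (by omega : k ≠ m)]
      exact h.2 k hlt
    · simpa using shuffleStep_update t (b k) i
  · have hsum : ∑ k ∈ Finset.range m, Function.update c m (b m i + 1) k =
        ∑ k ∈ Finset.range m, c k :=
      Finset.sum_congr rfl fun k hk => Function.update_of_ne (Finset.mem_range.1 hk).ne _ _
    rw [Finset.sum_range_succ, Function.update_self, hsum]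
    omega

theorem exists_isRun {t : ℕ} (ht : 1 ≤ t) (n : ℕ) : ∃ b c, IsRun t n b c := by
  induction n with
  | zero => exact ⟨0, 0, by simp [IsRun]⟩
  | succ n ih =>
    obtain ⟨b, c, h⟩ := ih
    obtain ⟨b', c', h', _⟩ := h.exists_extend ht
    exact ⟨b', c', h'⟩

/-- The minimum cost is attained. -/
theorem exists_isRun_shuffleCost {t : ℕ} (ht : 1 ≤ t) (n : ℕ) :
    ∃ b c, IsRun t n b c ∧ shuffleCost t n = ∑ k ∈ Finset.range n, c k := by
  obtain ⟨b, c, h⟩ := exists_isRun ht n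
  exact Nat.sInf_mem
    (s := { s | ∃ b c, IsRun t n b c ∧ s = ∑ k ∈ Finset.range n, c k }) ⟨_, b, c, h, rfl⟩

theorem shuffleCost_le {t n : ℕ} {b : ℕ → Fin t → ℕ} {c : ℕ → ℕ} (h : IsRun t n b c) :
    shuffleCost t n ≤ ∑ k ∈ Finset.range n, c k :=
  Nat.sInf_le ⟨b, c, h, rfl⟩

/-- One can run the optimal algorithm for n−1 balls with t bins and then put the
last ball into the smallest bin, at cost at most 1 + floor((n−1)/t); hence
f_t(n) ≤ f_t(n−1) + 1 + floor((n−1)/t). -/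
theorem shuffleCost_succ_upper_bound (n t : ℕ) (hn : 1 ≤ n) (ht : 1 ≤ t) :
    shuffleCost t n ≤ shuffleCost t (n - 1) + 1 + (n - 1) / t := by
  obtain ⟨m, rfl⟩ := Nat.exists_eq_add_of_le' hn
  obtain ⟨b, c, h, hc⟩ := exists_isRun_shuffleCost ht m
  obtain ⟨b', c', h', hle⟩ := h.exists_extend ht
  rw [Nat.add_sub_cancel, hc]
  exact (shuffleCost_le h').trans hle
end
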